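/- The win-lose bimatrix game Ĝ₃ has no uniform Nash equilibrium. -/

import Mathlib

open Finset

/-- `x` is a probability distribution on the finite type `α`. -/
def IsDist {α : Type*} [Fintype α] (x : α → ℝ) : Prop :=
  (∀ s, 0 ≤ x s) ∧ ∑ s, x s = 1

/-- Expected utility, in a bimatrix game, of the player whose utility matrix is `M`. -/
noncomputable def pay {α : Type*} [Fintype α] (M : α → α → ℝ) (x y : α → ℝ) : ℝ :=
  ∑ s₁, ∑ s₂, x s₁ * y s₂ * M s₁ s₂

/-- `⟨x, y⟩` is a (mixed) Nash equilibrium of the bimatrix game `⟨R, C⟩`. -/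
def IsNash {α : Type*} [Fintype α] (R C : α → α → ℝ) (x y : α → ℝ) : Prop :=
  IsDist x ∧ IsDist y ∧
    (∀ x', IsDist x' → pay R x' y ≤ pay R x y) ∧
    (∀ y', IsDist y' → pay C x y' ≤ pay C x y)

/-- The mixed strategy `x` is uniform: it assigns equal probability to all
strategies in its support. -/
def Uniform {α : Type*} (x : α → ℝ) : Prop :=
  ∀ s t, 0 < x s → 0 < x t → x s = x t

/-- Utility matrix of the row player in the game `Ĝ₃`. -/
noncomputable def G3R : Fin 4 → Fin 4 → ℝ :=
  ![![0, 0, 1, 1], ![0, 1, 1, 0], ![0, 1, 0, 1], ![1, 0, 0, 0]]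

/-- Utility matrix of the column player in the game `Ĝ₃`. -/
noncomputable def G3C : Fin 4 → Fin 4 → ℝ :=
  ![![1, 1, 0, 0], ![1, 0, 0, 1], ![1, 0, 1, 0], ![0, 1, 1, 1]]

/-- The win-lose bimatrix game `Ĝ₃` has no uniform Nash equilibrium. -/
theorem G3_no_uniform_nash :
    ¬ ∃ x y : Fin 4 → ℝ, IsNash G3R G3C x y ∧ Uniform x ∧ Uniform y := by
  rintro ⟨x, y, ⟨⟨hx0, hx⟩, ⟨hy0, hy⟩, hR, hC⟩, -, hUy⟩
  have hd : ∀ i : Fin 4, IsDist (Pi.single i (1 : ℝ) : Fin 4 → ℝ) := by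
    intro i
    refine ⟨fun s => ?_, by simp⟩
    by_cases h : s = i
    · subst h; simp
    · simp [h]
  have hsum : pay G3R x y + pay G3C x y = 1 := by
    have h : pay G3R x y + pay G3C x y = (∑ s, x s) * (∑ s, y s) := by
      simp [pay, G3R, G3C, Fin.sum_univ_four]
      ring
    rw [h, hx, hy, one_mul]
  have r0 := hR _ (hd 0)
  have r1 := hR _ (hd 1)
  have r2 := hR _ (hd 2)
  have r3 := hR _ (hd 3)
  have c0 := hC _ (hd 0)
  have c1 := hC _ (hd 1)
  have c2 := hC _ (hd 2)
  have c3 := hC _ (hd 3)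
  generalize pay G3R x y = v at *
  generalize pay G3C x y = w at *
  simp [pay, G3R, G3C, Fin.sum_univ_four, Pi.single_apply] at r0 r1 r2 r3 c0 c1 c2 c3
  rw [Fin.sum_univ_four] at hx hy
  -- the value of the game is 2/5, and the column strategy is forced to be (2/5, 1/5, 1/5, 1/5)
  have e0 : y 0 = 2 / 5 := by linarith
  have e1 : y 1 = 1 / 5 := by linarith
  have := hUy 0 1 (by rw [e0]; norm_num) (by rw [e1]; norm_num)
  rw [e0, e1] at this
  norm_num at this
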